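/- arXiv:1209.6381 — 6 statements merged into one kernel-verified Lean document; each statement's English description precedes it below -/
import Mathlib

section
/- The complement of D̃ in S² × S² × S² has exactly two connected components. Moreover, two points (u, v, w) and (u', v', w') of the complement lie in the same connected component if and only if the coordinates v 2 and v' 2 are either both positive or both negative (i.e., the components are distinguished by the open hemisphere of the second sphere factor containing the second coordinate). -/
noncomputable section

open Metric Set

/-- `E³ = EuclideanSpace ℝ (Fin 3)`. -/
abbrev E3 := EuclideanSpace ℝ (Fin 3)

/-- The unit sphere `S²` in `E³`. -/
def S2 : Set E3 := Metric.sphere 0 1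

/-- The equator `C = {v ∈ S² : v 2 = 0}`. -/
def Ceq : Set E3 := {v ∈ S2 | v 2 = 0}

/-- The closed half-equator `C₊ = {v ∈ C : v 0 ≥ 0}`. -/
def Cpos : Set E3 := {v ∈ Ceq | 0 ≤ v 0}

/-- The closed half-equator `C₋ = {v ∈ C : v 0 ≤ 0}`. -/
def Cneg : Set E3 := {v ∈ Ceq | v 0 ≤ 0}

/-- The closed upper hemisphere `H₊`. -/
def Hpos : Set E3 := {v ∈ S2 | 0 ≤ v 2}

/-- The closed lower hemisphere `H₋`. -/
def Hneg : Set E3 := {v ∈ S2 | v 2 ≤ 0}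

/-- The set `D̃ ⊆ S² × S² × S²`. -/
def Dtilde : Set (E3 × E3 × E3) :=
  (Cpos ×ˢ S2 ×ˢ S2) ∪ (S2 ×ˢ Ceq ×ˢ S2) ∪ (S2 ×ˢ S2 ×ˢ Cneg) ∪
    (Hpos ×ˢ Hpos ×ˢ Hpos) ∪ (Hneg ×ˢ Hneg ×ˢ Hneg)

/-- The complement of `D̃` in `S² × S² × S²`. -/
def CompSet : Set (E3 × E3 × E3) := (S2 ×ˢ S2 ×ˢ S2) \ Dtilde

/-- The trace on the unit sphere of a connected cone avoiding the origin is connected. -/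
lemma isPreconnected_sphere_inter_of_cone {E : Type*} [NormedAddCommGroup E] [NormedSpace ℝ E]
    {K : Set E} (hK : IsPreconnected K) (h0 : (0 : E) ∉ K)
    (hcone : ∀ x ∈ K, ∀ c : ℝ, 0 < c → c • x ∈ K) :
    IsPreconnected (sphere (0 : E) 1 ∩ K) := by
  have hne : ∀ x ∈ K, ‖x‖ ≠ 0 := fun x hx h => h0 (norm_eq_zero.mp h ▸ hx)
  have himage : (fun x : E => ‖x‖⁻¹ • x) '' K = sphere (0 : E) 1 ∩ K := by
    ext y
    constructor
    · rintro ⟨x, hx, rfl⟩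
      refine ⟨?_, hcone x hx _ (inv_pos.mpr (lt_of_le_of_ne (norm_nonneg x) (hne x hx).symm))⟩
      simp [norm_smul, hne x hx]
    · rintro ⟨hy, hyK⟩
      exact ⟨y, hyK, by simp [mem_sphere_zero_iff_norm.mp hy]⟩
  rw [← himage]
  exact hK.image _ ((continuousOn_id.norm.inv₀ hne).smul continuousOn_id)

lemma isPreconnected_open_hemisphere (ε : ℝ) : IsPreconnected {x ∈ S2 | 0 < ε * x 2} := by
  refine isPreconnected_sphere_inter_of_cone (K := {x : E3 | 0 < ε * x 2}) ?_ (by simp) ?_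
  · refine Convex.isPreconnected fun x hx y hy a b ha hb hab => ?_
    simp only [mem_ofPred_eq, PiLp.add_apply, PiLp.smul_apply, smul_eq_mul] at *
    rcases ha.eq_or_lt with rfl | ha
    · simp_all
    · nlinarith [mul_pos ha hx, mul_nonneg hb hy.le]
  · intro x hx c hc
    simp only [mem_ofPred_eq, PiLp.smul_apply, smul_eq_mul] at *
    nlinarith [mul_pos hc hx]

/-- The sphere minus a closed half-equator is connected. -/
lemma isPreconnected_slit_sphere {ε : ℝ} (hε : ε ≠ 0) :
    IsPreconnected {x ∈ S2 | x 2 ≠ 0 ∨ 0 < ε * x 0} := by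
  refine isPreconnected_sphere_inter_of_cone (K := {x : E3 | x 2 ≠ 0 ∨ 0 < ε * x 0}) ?_
    (by simp) ?_
  · have hstar : StarConvex ℝ (EuclideanSpace.single 0 ε : E3)
        {x : E3 | x 2 ≠ 0 ∨ 0 < ε * x 0} := by
      intro y hy a b ha hb hab
      have hpos : 0 < ε * ε := mul_self_pos.mpr hε
      simp only [mem_ofPred_eq, PiLp.add_apply, PiLp.smul_apply, smul_eq_mul,
        PiLp.single_apply] at *
      rcases hb.eq_or_lt with rfl | hb
      · right
        simp_all
      rcases hy with hy | hy
      · left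
        simp [hb.ne', hy]
      · right
        simp only [if_true]
        nlinarith [mul_pos hb hy, mul_nonneg ha hpos.le]
    refine (hstar.isPathConnected (Or.inr ?_)).isConnected.isPreconnected
    simpa using mul_self_pos.mpr hε
  · intro x hx c hc
    simp only [mem_ofPred_eq, PiLp.smul_apply, smul_eq_mul] at *
    rcases hx with hx | hx
    · exact Or.inl (mul_ne_zero hc.ne' hx)
    · right
      nlinarith [mul_pos hc hx]

/-- The part of `CompSet` whose middle coordinate lies in the open hemisphere of sign `ε` is
connected. -/
lemma isPreconnected_compSet_inter {ε : ℝ} (hε : ε = 1 ∨ ε = -1) :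
    IsPreconnected {p ∈ CompSet | 0 < ε * p.2.1 2} := by
  have hA := (isPreconnected_open_hemisphere (-ε)).prod
    ((isPreconnected_open_hemisphere ε).prod (isPreconnected_slit_sphere one_ne_zero))
  have hB := (isPreconnected_slit_sphere (neg_ne_zero.mpr one_ne_zero)).prod
    ((isPreconnected_open_hemisphere ε).prod (isPreconnected_open_hemisphere (-ε)))
  have hε2 : ε * ε = 1 := by rcases hε with rfl | rfl <;> norm_num
  have hmem : ∀ δ : ℝ, δ = 1 ∨ δ = -1 → (EuclideanSpace.single 2 δ : E3) ∈ S2 := by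
    rintro δ (rfl | rfl) <;> simp [S2]
  have hm₁ := hmem ε hε
  have hm₂ := hmem (-ε) (by rcases hε with rfl | rfl <;> simp)
  have hne : ε ≠ 0 := by rcases hε with rfl | rfl <;> norm_num
  convert hA.union (EuclideanSpace.single 2 (-ε), EuclideanSpace.single 2 ε,
    EuclideanSpace.single 2 (-ε)) ?_ ?_ hB using 1
  · clear hA hB hmem hm₁ hm₂ hε2 hne
    ext ⟨u, v, w⟩
    simp only [CompSet, Dtilde, Cpos, Cneg, Ceq, Hpos, Hneg, mem_ofPred_eq, mem_sdiff, mem_union,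
      mem_prod]
    by_cases hu : u ∈ S2
    swap
    · simp [hu]
    by_cases hv : v ∈ S2
    swap
    · simp [hv]
    by_cases hw : w ∈ S2
    swap
    · simp [hw]
    simp only [hu, hv, hw, true_and, and_true]
    generalize u 0 = u₀, u 2 = u₂, v 2 = v₂, w 0 = w₀, w 2 = w₂
    rcases hε with rfl | rfl <;> grind
  · simp [hm₁, hm₂, hε2, hne]
  · simp [hm₁, hm₂, hε2, hne]

lemma second_coord_ne_zero (p : ↥CompSet) : (p : E3 × E3 × E3).2.1 2 ≠ 0 := by
  intro h
  exact p.2.2 (Or.inl (Or.inl (Or.inl (Or.inr ⟨p.2.1.1, ⟨p.2.1.2.1, h⟩, p.2.1.2.2⟩))))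

lemma mem_connectedComponent_compSet {ε : ℝ} (hε : ε = 1 ∨ ε = -1) {p q : ↥CompSet}
    (hp : 0 < ε * (p : E3 × E3 × E3).2.1 2) (hq : 0 < ε * (q : E3 × E3 × E3).2.1 2) :
    q ∈ connectedComponent p := by
  have h : IsPreconnected {x : ↥CompSet | 0 < ε * (x : E3 × E3 × E3).2.1 2} := by
    rw [← Topology.IsInducing.subtypeVal.isPreconnected_image]
    convert isPreconnected_compSet_inter hε using 1
    ext x
    simpa using and_comm
  exact h.subset_connectedComponent hp hq

lemma isClopen_second_coord_pos : IsClopen {x : ↥CompSet | 0 < (x : E3 × E3 × E3).2.1 2} := by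
  have hc : Continuous fun x : ↥CompSet => (x : E3 × E3 × E3).2.1 2 := by fun_prop
  refine ⟨?_, isOpen_lt continuous_const hc⟩
  convert isClosed_le continuous_const hc using 1
  ext x
  simp only [mem_ofPred_eq]
  exact ⟨le_of_lt, fun h => lt_of_le_of_ne h (second_coord_ne_zero x).symm⟩

lemma mem_connectedComponent_compSet_iff (p q : ↥CompSet) :
    q ∈ connectedComponent p ↔
      ((0 < (p : E3 × E3 × E3).2.1 2 ∧ 0 < (q : E3 × E3 × E3).2.1 2) ∨
       ((p : E3 × E3 × E3).2.1 2 < 0 ∧ (q : E3 × E3 × E3).2.1 2 < 0)) := by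
  constructor
  · intro h
    rcases (second_coord_ne_zero p).lt_or_gt with hp | hp
    · refine Or.inr ⟨hp, (second_coord_ne_zero q).lt_or_gt.resolve_right fun hq => ?_⟩
      have hpq := isClopen_second_coord_pos.connectedComponent_subset hq
        (connectedComponent_eq h ▸ mem_connectedComponent)
      exact lt_asymm hp hpq
    · exact Or.inl ⟨hp, isClopen_second_coord_pos.connectedComponent_subset hp h⟩
  · rintro (⟨hp, hq⟩ | ⟨hp, hq⟩)
    · exact mem_connectedComponent_compSet (Or.inl rfl) (by simpa) (by simpa)
    · exact mem_connectedComponent_compSet (Or.inr rfl) (by simpa) (by simpa)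

lemma exists_compSet_second_coord_eq {ε : ℝ} (hε : ε = 1 ∨ ε = -1) :
    ∃ p : ↥CompSet, (p : E3 × E3 × E3).2.1 2 = ε := by
  refine ⟨⟨(EuclideanSpace.single 2 (-ε), EuclideanSpace.single 2 ε,
    EuclideanSpace.single 2 (-ε)), ?_⟩, by simp⟩
  rcases hε with rfl | rfl <;>
    norm_num [CompSet, Dtilde, Cpos, Cneg, Ceq, Hpos, Hneg, S2]

/-- The complement of `D̃` in `S² × S² × S²` has exactly two connected components, and two
points lie in the same component iff the `v 2` coordinates of their second sphere factors
are both positive or both negative. -/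
theorem two_components_of_complement_of_degenerate_locus :
    Nat.card (ConnectedComponents ↥CompSet) = 2 ∧
    ∀ p q : ↥CompSet,
      (q ∈ connectedComponent p ↔
        ((0 < (p : E3 × E3 × E3).2.1 2 ∧ 0 < (q : E3 × E3 × E3).2.1 2) ∨
         ((p : E3 × E3 × E3).2.1 2 < 0 ∧ (q : E3 × E3 × E3).2.1 2 < 0))) := by
  refine ⟨?_, mem_connectedComponent_compSet_iff⟩
  obtain ⟨p, hp⟩ := exists_compSet_second_coord_eq (Or.inl rfl)
  obtain ⟨q, hq⟩ := exists_compSet_second_coord_eq (Or.inr rfl)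
  rw [Nat.card_eq_two_iff]
  refine ⟨(p : ConnectedComponents ↥CompSet), q, ?_, eq_univ_of_forall fun x => ?_⟩
  · rw [Ne, ConnectedComponents.coe_eq_coe', mem_connectedComponent_compSet_iff, hp, hq]
    norm_num
  · obtain ⟨x, rfl⟩ := ConnectedComponents.surjective_coe x
    simp only [mem_insert_iff, mem_singleton_iff, ConnectedComponents.coe_eq_coe',
      mem_connectedComponent_compSet_iff, hp, hq]
    rcases (second_coord_ne_zero x).lt_or_gt with hx | hx
    · exact Or.inr (Or.inr ⟨by norm_num, hx⟩)
    · exact Or.inl (Or.inl ⟨by norm_num, hx⟩)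
end
end

section
/- Let L be a 3-component string link with parameter R > 0. For every ε > 0 there exists T > 0 such that for all t₁, t₂, t₃ ∈ ℝ and x ∈ E³ with x ≠ L(i, tᵢ) for i = 1, 2, 3 and with max(|t₁|, |t₂|, |t₃|, ‖x‖) ≥ T, the point (unit(x − L(1,t₁)), unit(x − L(2,t₂)), unit(x − L(3,t₃))) of S² × S² × S² lies within distance ε of the set D̃. (In other words, the accumulation set at infinity of the Gauss map Φ_T of a configuration of one point on each strand and one free point is contained in the degenerate locus D̃.) -/
noncomputable section

open Metric Set

/-- The vector `(a, b, c)` in `E³`. -/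
def mkE3 (a b c : ℝ) : E3 := (WithLp.equiv 2 (Fin 3 → ℝ)).symm ![a, b, c]

/-- `unit(w) = ‖w‖⁻¹ • w`. -/
def unitVec (w : E3) : E3 := ‖w‖⁻¹ • w

/-- `dᵢ⁺`: the unit vector in the direction `(i − (k+1)/2, 1, 0)`, where the components of a
`k`-component string link are indexed by `i = 1, …, k` (so `i : Fin k` stands for `i + 1`). -/
def dplus (k : ℕ) (i : Fin k) : E3 :=
  unitVec (mkE3 ((i : ℝ) + 1 - ((k : ℝ) + 1) / 2) 1 0)

/-- `dᵢ⁻`: the unit vector in the direction `(i − (k+1)/2, −1, 0)`. -/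
def dminus (k : ℕ) (i : Fin k) : E3 :=
  unitVec (mkE3 ((i : ℝ) + 1 - ((k : ℝ) + 1) / 2) (-1) 0)

/-- A `k`-component string link with parameter `R`. -/
def IsStringLink (k : ℕ) (R : ℝ) (L : Fin k × ℝ → E3) : Prop :=
  Continuous L ∧ Function.Injective L ∧
    (∀ i t, |t| ≤ R → ‖L (i, t)‖ ≤ R) ∧
    (∀ i t, R ≤ t → L (i, t) = t • dplus k i) ∧
    (∀ i t, t ≤ -R → L (i, t) = (-t) • dminus k i)

theorem unitVec_apply (w : E3) (i : Fin 3) : unitVec w i = ‖w‖⁻¹ * w i := by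
  simp [unitVec]

theorem norm_unitVec {w : E3} (hw : w ≠ 0) : ‖unitVec w‖ = 1 := by
  rw [unitVec, norm_smul, norm_inv, norm_norm, inv_mul_cancel₀ (norm_ne_zero_iff.mpr hw)]

theorem unitVec_mem_S2 {w : E3} (hw : w ≠ 0) : unitVec w ∈ S2 := by
  simp [S2, norm_unitVec hw]

@[simp]
theorem mkE3_zero (a b c : ℝ) : mkE3 a b c 0 = a := rfl

@[simp]
theorem mkE3_one (a b c : ℝ) : mkE3 a b c 1 = b := rfl

@[simp]
theorem mkE3_two (a b c : ℝ) : mkE3 a b c 2 = c := rfl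

theorem norm_mkE3 (a b c : ℝ) : ‖mkE3 a b c‖ = √(a ^ 2 + b ^ 2 + c ^ 2) := by
  simp [EuclideanSpace.norm_eq, Fin.sum_univ_three]

theorem abs_coord_le_norm (w : E3) (i : Fin 3) : |w i| ≤ ‖w‖ := by
  simpa using PiLp.norm_apply_le w i

theorem norm_sub_mkE3_le (w : E3) (a : ℝ) : ‖w - mkE3 a (w 1) 0‖ ≤ |w 0 - a| + |w 2| := by
  rw [EuclideanSpace.norm_eq]
  apply Real.sqrt_le_iff.mpr
  refine ⟨by positivity, ?_⟩
  simp only [Fin.sum_univ_three, PiLp.sub_apply, mkE3_zero, mkE3_one, mkE3_two, Real.norm_eq_abs,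
    sub_self, sub_zero, abs_zero]
  nlinarith [mul_nonneg (abs_nonneg (w 0 - a)) (abs_nonneg (w 2))]

/-- Normalization is almost constant on bounded perturbations of long vectors. -/
theorem dist_unitVec_le {ε D : ℝ} (hε : 0 < ε) {w w' : E3} (h : ‖w - w'‖ ≤ D)
    (hw : 2 * D / ε + D + 1 ≤ ‖w‖) : w' ≠ 0 ∧ dist (unitVec w) (unitVec w') ≤ ε := by
  have hD : 0 ≤ D := (norm_nonneg _).trans h
  have hq : 0 ≤ 2 * D / ε := by positivity
  have hpos : 0 < ‖w‖ := by linarith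
  have hw' : w' ≠ 0 := by
    rintro rfl
    rw [sub_zero] at h
    linarith
  refine ⟨hw', ?_⟩
  have hdiff : unitVec w - unitVec w' =
      ‖w‖⁻¹ • (w - w') + (‖w‖⁻¹ * (‖w'‖ - ‖w‖)) • unitVec w' := by
    have e : ‖w‖⁻¹ • w' = (‖w‖⁻¹ * ‖w'‖) • unitVec w' := by
      rw [unitVec, smul_smul, mul_assoc, mul_inv_cancel₀ (norm_ne_zero_iff.mpr hw'), mul_one]
    rw [smul_sub, e, mul_sub, inv_mul_cancel₀ hpos.ne', sub_smul, one_smul]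
    simp only [unitVec]
    abel
  have habs : |‖w'‖ - ‖w‖| ≤ D := by
    rw [abs_sub_comm]
    exact (abs_norm_sub_norm_le w w').trans h
  calc dist (unitVec w) (unitVec w') = ‖unitVec w - unitVec w'‖ := dist_eq_norm _ _
    _ ≤ ‖w‖⁻¹ * ‖w - w'‖ + ‖w‖⁻¹ * |‖w'‖ - ‖w‖| := by
      rw [hdiff]
      refine (norm_add_le _ _).trans_eq ?_
      rw [norm_smul, norm_smul, norm_unitVec hw', mul_one, norm_mul, norm_inv, norm_norm,
        Real.norm_eq_abs]
    _ ≤ ‖w‖⁻¹ * D + ‖w‖⁻¹ * D := by gcongr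
    _ = 2 * D / ‖w‖ := by field_simp; ring
    _ ≤ ε := by
      rw [div_le_iff₀ hpos, ← div_le_iff₀' hε]
      linarith

/-- A long vector of bounded height whose first coordinate is close to `a` points almost in the
direction of a point of the equator with first coordinate of the sign of `a`. -/
theorem exists_mem_Ceq_dist_unitVec_le {ε D a : ℝ} (hε : 0 < ε) {w : E3}
    (h : |w 0 - a| + |w 2| ≤ D) (hw : 2 * D / ε + D + 1 ≤ ‖w‖) :
    ∃ v ∈ Ceq, (0 ≤ a → 0 ≤ v 0) ∧ (a ≤ 0 → v 0 ≤ 0) ∧ dist (unitVec w) v ≤ ε := by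
  obtain ⟨h0, hd⟩ := dist_unitVec_le hε ((norm_sub_mkE3_le w a).trans h) hw
  refine ⟨_, ⟨unitVec_mem_S2 h0, by simp [unitVec_apply]⟩, fun ha => ?_, fun ha => ?_, hd⟩
  · rw [unitVec_apply]
    exact mul_nonneg (by positivity) ha
  · rw [unitVec_apply]
    exact mul_nonpos_of_nonneg_of_nonpos (by positivity) ha

theorem mkE3_ne_zero_of_one_ne_zero {a b c : ℝ} (hb : b ≠ 0) : mkE3 a b c ≠ 0 := by
  intro h
  exact hb (by simpa using congrArg (fun v : E3 => v 1) h)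

/-- Each point of a string link lies in the ball of radius `R` or on one of the straight rays. -/
theorem IsStringLink.bounded_or_ray {k : ℕ} {R : ℝ} {L : Fin k × ℝ → E3}
    (hL : IsStringLink k R L) (hR : 0 < R) (i : Fin k) (t : ℝ) :
    (|t| ≤ R ∧ ‖L (i, t)‖ ≤ R) ∨
      (‖L (i, t)‖ = |t| ∧ L (i, t) 2 = 0 ∧
        L (i, t) 0 = |t| * ((√(((i : ℝ) + 1 - ((k : ℝ) + 1) / 2) ^ 2 + 1))⁻¹ *
          ((i : ℝ) + 1 - ((k : ℝ) + 1) / 2))) := by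
  obtain ⟨-, -, hb, hp, hm⟩ := hL
  rcases le_or_gt |t| R with h | h
  · exact Or.inl ⟨h, hb i t h⟩
  right
  rcases lt_abs.mp h with h | h
  · have ht : |t| = t := abs_of_pos (by linarith)
    rw [hp i t h.le]
    refine ⟨?_, ?_, ?_⟩
    · rw [dplus, norm_smul, norm_unitVec (mkE3_ne_zero_of_one_ne_zero one_ne_zero), mul_one,
        Real.norm_eq_abs]
    · simp [dplus, unitVec_apply]
    · simp [dplus, unitVec_apply, norm_mkE3, ht]
  · have ht : |t| = -t := abs_of_neg (by linarith)
    rw [hm i t (by linarith)]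
    refine ⟨?_, ?_, ?_⟩
    · rw [dminus, norm_smul,
        norm_unitVec (mkE3_ne_zero_of_one_ne_zero (neg_ne_zero.mpr one_ne_zero)), mul_one,
        Real.norm_eq_abs, abs_neg]
    · simp [dminus, unitVec_apply]
    · simp [dminus, unitVec_apply, norm_mkE3, ht]

theorem half_le_inv_sqrt_two : 1 / 2 ≤ (√2)⁻¹ := by
  rw [one_div]
  apply inv_anti₀ (by positivity)
  exact Real.sqrt_le_iff.mpr ⟨by norm_num, by norm_num⟩

/-- Three vectors on the same side of the horizontal plane normalize to a point of `D̃`. -/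
theorem unitVec_mem_Dtilde_of_same_side {u v w : E3} (hu : u ≠ 0) (hv : v ≠ 0) (hw : w ≠ 0)
    (h : (0 ≤ u 2 ∧ 0 ≤ v 2 ∧ 0 ≤ w 2) ∨ (u 2 ≤ 0 ∧ v 2 ≤ 0 ∧ w 2 ≤ 0)) :
    (unitVec u, unitVec v, unitVec w) ∈ Dtilde := by
  have hpos : ∀ {u : E3}, u ≠ 0 → 0 ≤ u 2 → unitVec u ∈ Hpos := fun hu h =>
    ⟨unitVec_mem_S2 hu, by rw [unitVec_apply]; exact mul_nonneg (by positivity) h⟩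
  have hneg : ∀ {u : E3}, u ≠ 0 → u 2 ≤ 0 → unitVec u ∈ Hneg := fun hu h =>
    ⟨unitVec_mem_S2 hu, by
      rw [unitVec_apply]; exact mul_nonpos_of_nonneg_of_nonpos (by positivity) h⟩
  rcases h with ⟨h0, h1, h2⟩ | ⟨h0, h1, h2⟩
  · exact Or.inl (Or.inr ⟨hpos hu h0, hpos hv h1, hpos hw h2⟩)
  · exact Or.inr ⟨hneg hu h0, hneg hv h1, hneg hw h2⟩

/-- Near infinity, the Gauss map of a configuration of one point on each strand of a
3-component string link and one free point lands in an arbitrarily small neighborhood of the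
degenerate locus `D̃`. -/
theorem gauss_map_near_infinity_close_to_degenerate_locus
    (R : ℝ) (hR : 0 < R) (L : Fin 3 × ℝ → E3) (hL : IsStringLink 3 R L) :
    ∀ ε > (0 : ℝ), ∃ T > (0 : ℝ), ∀ (t : Fin 3 → ℝ) (x : E3),
      (∀ i : Fin 3, x ≠ L (i, t i)) →
      T ≤ max (max |t 0| |t 1|) (max |t 2| ‖x‖) →
      Metric.infDist
        (unitVec (x - L (0, t 0)), unitVec (x - L (1, t 1)), unitVec (x - L (2, t 2)))
        Dtilde ≤ ε := by
  intro ε hε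
  set M : ℝ := 2 * (2 * R) / ε + 2 * R + 1 with hM
  set N : ℝ := 2 * (M + 4 * R) / ε + (M + 4 * R) + 1 with hN
  have hM0 : 0 < M := by positivity
  have hMN : M ≤ N := by
    have : 0 ≤ 2 * (M + 4 * R) / ε := by positivity
    linarith
  refine ⟨8 * (N + R), by linarith, fun t x hx hT => ?_⟩
  have hne : ∀ i, x - L (i, t i) ≠ 0 := fun i => sub_ne_zero.mpr (hx i)
  have hS : ∀ i, unitVec (x - L (i, t i)) ∈ S2 := fun i => unitVec_mem_S2 (hne i)
  have close : ∀ p ∈ Dtilde,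
      dist (unitVec (x - L (0, t 0)), unitVec (x - L (1, t 1)), unitVec (x - L (2, t 2))) p ≤ ε →
      infDist (unitVec (x - L (0, t 0)), unitVec (x - L (1, t 1)), unitVec (x - L (2, t 2)))
        Dtilde ≤ ε := fun p hp h => (infDist_le_dist_of_mem hp).trans h
  have hstrand := hL.bounded_or_ray hR
  have hheight : ∀ i, |L (i, t i) 2| ≤ R := fun i => by
    rcases hstrand i (t i) with ⟨-, h⟩ | ⟨-, h, -⟩
    · exact (abs_coord_le_norm _ _).trans h
    · rw [h, abs_zero]
      exact hR.le
  by_cases hx2 : |x 2| ≤ R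
  swap
  · refine close _ (unitVec_mem_Dtilde_of_same_side (hne 0) (hne 1) (hne 2) ?_) (by simp [hε.le])
    simp only [PiLp.sub_apply]
    have h0 := abs_le.mp (hheight 0)
    have h1 := abs_le.mp (hheight 1)
    have h2 := abs_le.mp (hheight 2)
    rcases lt_abs.mp (not_le.mp hx2) with h | h
    · left
      refine ⟨?_, ?_, ?_⟩ <;> linarith
    · right
      refine ⟨?_, ?_, ?_⟩ <;> linarith
  have hw2 : ∀ i, |(x - L (i, t i)) 2| ≤ 2 * R := fun i => by
    rw [PiLp.sub_apply]
    linarith [abs_sub (x 2) (L (i, t i) 2), hheight i]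
  rcases le_or_gt M ‖x - L (1, t 1)‖ with h1 | h1
  · obtain ⟨v, hv, -, -, hd⟩ := exists_mem_Ceq_dist_unitVec_le (a := (x - L (1, t 1)) 0) hε
      (by simpa using hw2 1) h1
    refine close (unitVec (x - L (0, t 0)), v, unitVec (x - L (2, t 2)))
      (Or.inl (Or.inl (Or.inl (Or.inr ⟨hS 0, hv, hS 2⟩)))) ?_
    simp [Prod.dist_eq, hd]
  have hn1 := abs_le.mp ((abs_coord_le_norm (x - L (1, t 1)) 0).trans h1.le)
  rw [PiLp.sub_apply] at hn1
  have hc := half_le_inv_sqrt_two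
  have hL0 : L (0, t 0) 0 ≤ R - |t 0| / 2 ∨ |t 0| ≤ R := by
    rcases hstrand 0 (t 0) with ⟨h, -⟩ | ⟨-, -, h⟩
    · exact Or.inr h
    · left
      norm_num at h
      rw [h]
      nlinarith [mul_le_mul_of_nonneg_left hc (abs_nonneg (t 0))]
  have hL2 : |t 2| / 2 - R ≤ L (2, t 2) 0 ∨ |t 2| ≤ R := by
    rcases hstrand 2 (t 2) with ⟨h, -⟩ | ⟨-, -, h⟩
    · exact Or.inr h
    · left
      norm_num at h
      rw [h]
      nlinarith [mul_le_mul_of_nonneg_left hc (abs_nonneg (t 2))]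
  have hL1 : |L (1, t 1) 0| ≤ R := by
    rcases hstrand 1 (t 1) with ⟨-, h⟩ | ⟨-, -, h⟩
    · exact (abs_coord_le_norm _ _).trans h
    · norm_num at h
      rw [h, abs_zero]
      exact hR.le
  have hball : ∀ i, |t i| ≤ R → |L (i, t i) 0| ≤ R := fun i h =>
    (abs_coord_le_norm _ _).trans (hL.2.2.1 i _ h)
  have hL1' := abs_le.mp hL1
  rcases le_or_gt N ‖x - L (0, t 0)‖ with h0 | h0
  · have hle : L (0, t 0) 0 ≤ R := by
      rcases hL0 with h | h
      · linarith [abs_nonneg (t 0)]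
      · exact (abs_le.mp (hball 0 h)).2
    obtain ⟨v, hv, hv0, -, hd⟩ := exists_mem_Ceq_dist_unitVec_le
      (a := max ((x - L (0, t 0)) 0) 0) (D := M + 4 * R) hε (by
        have : |(x - L (0, t 0)) 0 - max ((x - L (0, t 0)) 0) 0| ≤ M + 2 * R := by
          rw [PiLp.sub_apply]
          rcases max_cases (x 0 - L (0, t 0) 0) 0 with ⟨h, -⟩ | ⟨h, h'⟩
          · rw [h, sub_self, abs_zero]
            linarith
          · rw [h, sub_zero, abs_of_neg h']
            linarith
        linarith [hw2 0]) h0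
    refine close (v, unitVec (x - L (1, t 1)), unitVec (x - L (2, t 2)))
      (Or.inl (Or.inl (Or.inl (Or.inl ⟨⟨hv, hv0 (le_max_right _ _)⟩, hS 1, hS 2⟩)))) ?_
    simp [Prod.dist_eq, hd]
  rcases le_or_gt N ‖x - L (2, t 2)‖ with h2 | h2
  · have hle : -R ≤ L (2, t 2) 0 := by
      rcases hL2 with h | h
      · linarith [abs_nonneg (t 2)]
      · exact (abs_le.mp (hball 2 h)).1
    obtain ⟨v, hv, -, hv0, hd⟩ := exists_mem_Ceq_dist_unitVec_le
      (a := min ((x - L (2, t 2)) 0) 0) (D := M + 4 * R) hε (by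
        have : |(x - L (2, t 2)) 0 - min ((x - L (2, t 2)) 0) 0| ≤ M + 2 * R := by
          rw [PiLp.sub_apply]
          rcases min_cases (x 0 - L (2, t 2) 0) 0 with ⟨h, -⟩ | ⟨h, h'⟩
          · rw [h, sub_self, abs_zero]
            linarith
          · rw [h, sub_zero, abs_of_pos h']
            linarith
        linarith [hw2 2]) h2
    refine close (unitVec (x - L (0, t 0)), unitVec (x - L (1, t 1)), v)
      (Or.inl (Or.inl (Or.inr ⟨hS 0, hS 1, hv, hv0 (min_le_right _ _)⟩))) ?_
    simp [Prod.dist_eq, hd]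
  -- All three strand points are close to `x`, which bounds the whole configuration.
  exfalso
  have hn0 := abs_le.mp ((abs_coord_le_norm (x - L (0, t 0)) 0).trans h0.le)
  have hn2 := abs_le.mp ((abs_coord_le_norm (x - L (2, t 2)) 0).trans h2.le)
  rw [PiLp.sub_apply] at hn0 hn2
  have ht0 : |t 0| ≤ 4 * R + 4 * N := by
    rcases hL0 with h | h <;> linarith
  have ht2 : |t 2| ≤ 4 * R + 4 * N := by
    rcases hL2 with h | h <;> linarith
  have hp0 : ‖L (0, t 0)‖ ≤ 4 * R + 4 * N := by
    rcases hstrand 0 (t 0) with ⟨-, h⟩ | ⟨h, -⟩ <;> linarith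
  have hxn : ‖x‖ ≤ 4 * R + 5 * N := by
    linarith [norm_sub_norm_le x (L (0, t 0))]
  have ht1 : |t 1| ≤ 4 * R + 6 * N := by
    rcases hstrand 1 (t 1) with ⟨h, -⟩ | ⟨h, -⟩
    · linarith
    · have := norm_sub_norm_le (L (1, t 1)) x
      rw [norm_sub_rev] at this
      linarith
  have : max (max |t 0| |t 1|) (max |t 2| ‖x‖) < 8 * (N + R) := by
    refine max_lt (max_lt ?_ ?_) (max_lt ?_ ?_) <;> linarith
  linarith
end
end

section
/- Let L be a 3-component string link with parameter R > 0, and let F := {(t, x) ∈ (Fin 3 → ℝ) × E³ : x ≠ L(i, t i) for all i} with the subspace topology (the configuration space of one point on each strand of the link together with one free point in ℝ³). Then for any p : Fin 3 → E³ with pairwise distinct values, F is homeomorphic to (Fin 3 → ℝ) × {x ∈ E³ : x ≠ p i for all i}; that is, F is homeomorphic to the product of ℝ³ with the complement of three distinct points in ℝ³. -/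
noncomputable section

open Metric Set

section PointPushing

variable {ι X E : Type*} [Fintype ι] [TopologicalSpace X] [NormedAddCommGroup E]

/-- A continuous family of contracting perturbations of the identity is a homeomorphism over the
parameter space. -/
theorem exists_homeomorph_id_add [CompleteSpace E] (g : X × E → E) (hg : Continuous g)
    (κ : X → ℝ) (hκ : Continuous κ) (hκ0 : ∀ x, 0 ≤ κ x) (hκ1 : ∀ x, κ x < 1)
    (hlip : ∀ x u v, ‖g (x, u) - g (x, v)‖ ≤ κ x * ‖u - v‖) :
    ∃ H : X × E ≃ₜ X × E, ∀ z, H z = (z.1, z.2 + g z) := by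
  have hsurj : ∀ z : X × E, ∃ u, u + g (z.1, u) = z.2 := by
    rintro ⟨x, v⟩
    have hc : ContractingWith ⟨κ x, hκ0 x⟩ (fun u => v - g (x, u)) := by
      refine ⟨hκ1 x, LipschitzWith.of_dist_le_mul fun u w => ?_⟩
      rw [dist_eq_norm, dist_eq_norm, sub_sub_sub_cancel_left, norm_sub_rev]
      exact hlip x u w
    refine ⟨hc.fixedPoint, ?_⟩
    have h : v - g (x, hc.fixedPoint) = hc.fixedPoint := hc.fixedPoint_isFixedPt
    simpa using (sub_eq_iff_eq_add.1 h).symm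
  choose s hs using hsurj
  have hest : ∀ (z : X × E) (w : E), (1 - κ z.1) * ‖s z - w‖ ≤ ‖z.2 - (w + g (z.1, w))‖ := by
    intro z w
    have h1 : s z - w = (z.2 - (w + g (z.1, w))) - (g (z.1, s z) - g (z.1, w)) := by
      rw [← hs z]; abel
    have h2 := norm_sub_le (z.2 - (w + g (z.1, w))) (g (z.1, s z) - g (z.1, w))
    rw [← h1] at h2
    linarith [hlip z.1 (s z) w]
  have hs_cont : Continuous s := by
    refine continuous_iff_continuousAt.2 fun z => ?_
    have hpos : ∀ y : X × E, 0 < 1 - κ y.1 := fun y => sub_pos.2 (hκ1 y.1)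
    have hb : Continuous fun y : X × E =>
        ‖y.2 - (s z + g (y.1, s z))‖ / (1 - κ y.1) :=
      Continuous.div (by fun_prop) (by fun_prop) fun y => (hpos y).ne'
    have hb0 := hb.tendsto z
    simp only [hs, sub_self, norm_zero, zero_div] at hb0
    refine tendsto_iff_norm_sub_tendsto_zero.2
      (squeeze_zero (fun _ => norm_nonneg _) (fun y => ?_) hb0)
    rw [le_div_iff₀ (hpos y), mul_comm]
    exact hest y (s z)
  refine ⟨{ toFun := fun z => (z.1, z.2 + g z)
            invFun := fun z => (z.1, s z)
            left_inv := fun z => ?_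
            right_inv := fun z => Prod.ext rfl (hs z)
            continuous_toFun := by fun_prop
            continuous_invFun := by fun_prop }, fun z => rfl⟩
  have h := hest (z.1, z.2 + g z) z.2
  simp only [Prod.mk.eta, sub_self, norm_zero] at h
  have h0 : ‖s (z.1, z.2 + g z) - z.2‖ ≤ 0 :=
    nonpos_of_mul_nonpos_right h (sub_pos.2 (hκ1 z.1))
  exact Prod.ext rfl (sub_eq_zero.1 (norm_le_zero_iff.1 h0))

/-- A continuous lower bound for the pairwise distances in a configuration of points. -/
def separation (c : ι → E) : ℝ :=
  open Classical in ∏ q ∈ (Finset.univ : Finset ι).offDiag, min 1 (dist (c q.1) (c q.2))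

theorem continuous_separation : Continuous (separation : (ι → E) → ℝ) := by
  unfold separation
  fun_prop

theorem separation_pos {c : ι → E} (hc : Function.Injective c) : 0 < separation c := by
  refine Finset.prod_pos fun q hq => lt_min one_pos (dist_pos.2 fun h => ?_)
  exact (Finset.mem_offDiag.1 hq).2.2 (hc h)

theorem separation_le_dist (c : ι → E) {i j : ι} (hij : i ≠ j) :
    separation c ≤ dist (c i) (c j) := by
  classical
  have hmem : (i, j) ∈ (Finset.univ : Finset ι).offDiag := by simp [hij]
  unfold separation
  rw [← Finset.mul_prod_erase _ _ (by convert hmem)]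
  refine (mul_le_of_le_one_right (le_min zero_le_one dist_nonneg) ?_).trans (min_le_right _ _)
  exact Finset.prod_le_one (fun q _ => le_min zero_le_one dist_nonneg) fun q _ => min_le_left _ _

/-- The limit of a sequence of homeomorphisms which, together with their inverses, locally
stabilize. -/
theorem exists_homeomorph_of_eventually_const {Y : Type*} [TopologicalSpace Y] (H : ℕ → Y ≃ₜ Y)
    (hH : ∀ y, ∃ N, ∀ᶠ z in nhds y, ∀ n, N ≤ n →
      H n z = H N z ∧ (H n).symm z = (H N).symm z) :
    ∃ G : Y ≃ₜ Y, ∀ y, ∃ N, ∀ n, N ≤ n → G y = H n y := by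
  choose N hN using hH
  have key : ∀ y n, N y ≤ n → H n y = H (N y) y ∧ (H n).symm y = (H (N y)).symm y :=
    fun y => (hN y).self_of_nhds
  have hloc : ∀ y, ∀ᶠ z in nhds y,
      H (N z) z = H (N y) z ∧ (H (N z)).symm z = (H (N y)).symm z := by
    intro y
    filter_upwards [hN y] with z hz
    have h1 := hz _ (le_max_left (N y) (N z))
    have h2 := key z _ (le_max_right (N y) (N z))
    exact ⟨h2.1.symm.trans h1.1, h2.2.symm.trans h1.2⟩
  refine ⟨{ toFun := fun y => H (N y) y
            invFun := fun y => (H (N y)).symm y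
            left_inv := fun y => ?_
            right_inv := fun y => ?_
            continuous_toFun := continuous_iff_continuousAt.2 fun y => ?_
            continuous_invFun := continuous_iff_continuousAt.2 fun y => ?_ },
    fun y => ⟨N y, fun n hn => (key y n hn).1.symm⟩⟩
  · have h1 := (key y _ (le_max_left (N y) (N (H (N y) y)))).1
    have h2 := (key (H (N y) y) _ (le_max_right (N y) (N (H (N y) y)))).2
    change (H (N (H (N y) y))).symm (H (N y) y) = y
    rw [← h2, Homeomorph.symm_apply_eq, h1]
  · have h1 := (key y _ (le_max_left (N y) (N ((H (N y)).symm y)))).2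
    have h2 := (key ((H (N y)).symm y) _ (le_max_right (N y) (N ((H (N y)).symm y)))).1
    change H (N ((H (N y)).symm y)) ((H (N y)).symm y) = y
    rw [← h2, ← Homeomorph.eq_symm_apply, h1]
  · exact (H (N y)).continuous.continuousAt.congr ((hloc y).mono fun z hz => hz.1.symm)
  · exact (H (N y)).symm.continuous.continuousAt.congr ((hloc y).mono fun z hz => hz.2.symm)

/-- The composite of the first `n` members of a sequence of self-homeomorphisms. -/
def iterComp {Y : Type*} [TopologicalSpace Y] (Ψ : ℕ → Y ≃ₜ Y) : ℕ → Y ≃ₜ Y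
  | 0 => Homeomorph.refl Y
  | n + 1 => (iterComp Ψ n).trans (Ψ n)

/-- A locally finite infinite composition of homeomorphisms over `X`. -/
theorem exists_homeomorph_infinite_comp (Ψ : ℕ → X × E ≃ₜ X × E)
    (hfst : ∀ n z, (Ψ n z).1 = z.1)
    (hfin : ∀ x, ∃ N, ∀ᶠ y in nhds x, ∀ n, N ≤ n → ∀ v, Ψ n (y, v) = (y, v)) :
    ∃ G : X × E ≃ₜ X × E, (∀ z, (G z).1 = z.1) ∧
      ∀ z, ∃ N, ∀ n, N ≤ n → G z = iterComp Ψ n z := by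
  have hfst' : ∀ n z, (iterComp Ψ n z).1 = z.1 := by
    intro n
    induction n with
    | zero => intro z; rfl
    | succ n ih => intro z; exact (hfst n _).trans (ih z)
  suffices h : ∃ G : X × E ≃ₜ X × E, ∀ z, ∃ N, ∀ n, N ≤ n → G z = iterComp Ψ n z by
    obtain ⟨G, hG⟩ := h
    refine ⟨G, fun z => ?_, hG⟩
    obtain ⟨N, hN⟩ := hG z
    rw [hN N le_rfl, hfst']
  refine exists_homeomorph_of_eventually_const (iterComp Ψ) fun ⟨x, v⟩ => ?_
  obtain ⟨N, hN⟩ := hfin x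
  refine ⟨N, ?_⟩
  filter_upwards [continuous_fst.continuousAt.eventually hN] with z hz n hn
  have h1 : ∀ w : X × E, w.1 = z.1 → iterComp Ψ n w = iterComp Ψ N w := by
    intro w hw
    induction n, hn using Nat.le_induction with
    | base => rfl
    | succ n hn ih =>
      refine Eq.trans ?_ ih
      have h := hz n hn (iterComp Ψ n w).2
      rwa [← hw, ← hfst' n w] at h
  refine ⟨h1 z rfl, ?_⟩
  rw [Homeomorph.symm_apply_eq, h1 _ ?_, Homeomorph.apply_symm_apply]
  rw [← hfst' N, Homeomorph.apply_symm_apply]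

/-- A step size along the rays of `X`, continuous in the endpoint, that keeps consecutive
configurations close. -/
theorem exists_continuous_step {X : Type*} [NormedAddCommGroup X] [NormedSpace ℝ X]
    {c : X → ι → E} (hc : Continuous c) (hinj : ∀ x, Function.Injective (c x)) :
    ∃ ε : C(X, ℝ), (∀ x, 0 < ε x) ∧ ∀ x, ∀ s ∈ Set.Icc (0 : ℝ) 1,
      ∑ i, ‖c (min 1 (s + ε x) • x) i - c (s • x) i‖ < separation (c (s • x)) := by
  let T : X → Set ℝ := fun x => {ε | 0 < ε ∧ ∀ e ∈ Set.Icc 0 ε, ∀ s ∈ Set.Icc (0 : ℝ) 1,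
    ∑ i, ‖c (min 1 (s + e) • x) i - c (s • x) i‖ < separation (c (s • x))}
  have hconv : ∀ x, Convex ℝ (T x) := by
    intro x
    refine Set.OrdConnected.convex ⟨fun a ha b hb e he => ⟨ha.1.trans_le he.1, fun e' he' => ?_⟩⟩
    exact hb.2 e' ⟨he'.1, he'.2.trans he.2⟩
  have hloc : ∀ x, ∃ ε, ∀ᶠ y in nhds x, ε ∈ T y := by
    intro x
    have hev : ∀ᶠ q : X × ℝ in nhds (x, 0), ∀ s ∈ Set.Icc (0 : ℝ) 1,
        ∑ i, ‖c (min 1 (s + q.2) • q.1) i - c (s • q.1) i‖ < separation (c (s • q.1)) := by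
      refine isCompact_Icc.eventually_forall_of_forall_eventually fun s hs => ?_
      refine ContinuousAt.eventually_lt (Continuous.continuousAt ?_) (Continuous.continuousAt ?_) ?_
      · fun_prop
      · exact continuous_separation.comp (by fun_prop)
      · simpa [min_eq_right hs.2] using separation_pos (hinj (s • x))
    rw [nhds_prod_eq] at hev
    obtain ⟨P, hP, Q, hQ, hPQ⟩ := Filter.eventually_prod_iff.1 hev
    obtain ⟨δ, hδ, hball⟩ := Metric.eventually_nhds_iff.1 hQ
    refine ⟨δ / 2, hP.mono fun y hy => ⟨half_pos hδ, fun e he => ?_⟩⟩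
    refine hPQ hy (hball ?_)
    rw [Real.dist_eq, sub_zero, abs_of_nonneg he.1]
    linarith [he.2]
  obtain ⟨ε, hε⟩ := exists_continuous_forall_mem_convex_of_local_const hconv hloc
  exact ⟨ε, fun x => (hε x).1, fun x => (hε x).2 _ ⟨(hε x).1.le, le_rfl⟩⟩

variable [NormedSpace ℝ E]

/-- The displacement field `v ↦ ∑ i, max 0 (1 - ‖v - c i‖ / r) • (c' i - c i)` pushing each point
`c i` of a configuration to `c' i`, where `r` is the separation of `c`. -/
def pushField (c c' : ι → E) (v : E) : E :=
  ∑ i, max 0 (1 - ‖v - c i‖ / separation c) • (c' i - c i)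

theorem norm_pushField_sub_le {c : ι → E} (hc : Function.Injective c) (c' : ι → E) (u v : E) :
    ‖pushField c c' u - pushField c c' v‖ ≤
      (∑ i, ‖c' i - c i‖) / separation c * ‖u - v‖ := by
  have hr := separation_pos hc
  unfold pushField
  rw [← Finset.sum_sub_distrib, Finset.sum_div, Finset.sum_mul]
  refine norm_sum_le_of_le _ fun i _ => ?_
  rw [← sub_smul, norm_smul, Real.norm_eq_abs]
  have h1 : |max 0 (1 - ‖u - c i‖ / separation c) - max 0 (1 - ‖v - c i‖ / separation c)| ≤
      ‖u - v‖ / separation c := by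
    rw [max_comm 0, max_comm 0]
    refine (abs_max_sub_max_le_abs _ _ _).trans ?_
    rw [sub_sub_sub_cancel_left, ← sub_div, abs_div, abs_of_pos hr]
    gcongr
    refine (abs_norm_sub_norm_le _ _).trans_eq ?_
    rw [sub_sub_sub_cancel_right, norm_sub_rev]
  calc _ ≤ ‖u - v‖ / separation c * ‖c' i - c i‖ := by gcongr
    _ = _ := by ring

theorem add_pushField_apply {c : ι → E} (hc : Function.Injective c) (c' : ι → E) (j : ι) :
    c j + pushField c c' (c j) = c' j := by
  unfold pushField
  rw [Finset.sum_eq_single j]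
  · simp
  · intro i _ hij
    have h := separation_le_dist c hij
    rw [dist_comm, dist_eq_norm] at h
    rw [max_eq_left, zero_smul]
    rw [sub_nonpos, le_div_iff₀ (separation_pos hc), one_mul]
    exact h
  · simp

/-- A family of configurations can be pushed to any sufficiently close family. -/
theorem exists_homeomorph_push [CompleteSpace E] {c c' : X → ι → E} (hc : Continuous c)
    (hc' : Continuous c') (hinj : ∀ x, Function.Injective (c x))
    (hclose : ∀ x, ∑ i, ‖c' x i - c x i‖ < separation (c x)) :
    ∃ H : X × E ≃ₜ X × E, (∀ z, (H z).1 = z.1) ∧ (∀ x i, H (x, c x i) = (x, c' x i)) ∧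
      ∀ x, c' x = c x → ∀ v, H (x, v) = (x, v) := by
  have hpos := fun x => separation_pos (hinj x)
  have hsep : Continuous fun x => separation (c x) := continuous_separation.comp hc
  have hg : Continuous fun z : X × E => pushField (c z.1) (c' z.1) z.2 := by
    unfold pushField
    refine continuous_finsetSum _ fun i _ => Continuous.smul (continuous_const.max
      (continuous_const.sub (Continuous.div (by fun_prop) (hsep.comp continuous_fst)
        fun z => (hpos z.1).ne'))) (by fun_prop)
  obtain ⟨H, hH⟩ := exists_homeomorph_id_add _ hg
    (fun x => (∑ i, ‖c' x i - c x i‖) / separation (c x))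
    (Continuous.div (by fun_prop) hsep fun x => (hpos x).ne')
    (fun x => div_nonneg (Finset.sum_nonneg fun _ _ => norm_nonneg _) (hpos x).le)
    (fun x => (div_lt_one (hpos x)).2 (hclose x))
    (fun x u v => norm_pushField_sub_le (hinj x) _ u v)
  refine ⟨H, fun z => by rw [hH], fun x i => ?_, fun x hx v => ?_⟩
  · rw [hH, add_pushField_apply (hinj x)]
  · simp [hH, hx, pushField]

/-- A family of configurations over a normed space is trivialized by a family of ambient
homeomorphisms. -/
theorem exists_homeomorph_trivialize [CompleteSpace E] {X : Type*} [NormedAddCommGroup X]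
    [NormedSpace ℝ X] {c : X → ι → E} (hc : Continuous c)
    (hinj : ∀ x, Function.Injective (c x)) :
    ∃ H : X × E ≃ₜ X × E, (∀ z, (H z).1 = z.1) ∧ ∀ x i, H (x, c 0 i) = (x, c x i) := by
  obtain ⟨ε, hε, hstep⟩ := exists_continuous_step hc hinj
  let s : ℕ → X → ℝ := fun n x => min 1 (n * ε x)
  have hs_cont : ∀ n, Continuous (s n) := fun n => by fun_prop
  have hs_mem : ∀ n x, s n x ∈ Set.Icc (0 : ℝ) 1 := fun n x =>
    ⟨le_min zero_le_one (mul_nonneg n.cast_nonneg (hε x).le), min_le_left _ _⟩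
  have hs_succ : ∀ n x, s (n + 1) x = min 1 (s n x + ε x) := by
    intro n x
    have := hε x
    simp only [s, Nat.cast_add, Nat.cast_one, add_mul, one_mul]
    rcases le_total 1 ((n : ℝ) * ε x) with h | h
    · rw [min_eq_left h, min_eq_left, min_eq_left] <;> linarith
    · rw [min_eq_right h]
  have hs_one : ∀ x, ∃ N : ℕ, ∀ᶠ y in nhds x, ∀ n, N ≤ n → s n y = 1 := by
    intro x
    obtain ⟨N, hN⟩ := exists_nat_gt (1 / ε x)
    rw [div_lt_iff₀ (hε x)] at hN
    refine ⟨N, ?_⟩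
    have hcont : Continuous fun y => (N : ℝ) * ε y := by fun_prop
    filter_upwards [hcont.continuousAt.eventually (lt_mem_nhds hN)] with y hy n hn
    refine min_eq_left (hy.le.trans ?_)
    have := (hε y).le
    gcongr
  have hpush : ∀ n : ℕ, ∃ H : X × E ≃ₜ X × E, (∀ z, (H z).1 = z.1) ∧
      (∀ x i, H (x, c (s n x • x) i) = (x, c (s (n + 1) x • x) i)) ∧
      ∀ x, c (s (n + 1) x • x) = c (s n x • x) → ∀ v, H (x, v) = (x, v) := by
    intro n
    have hk : ∀ k, Continuous fun x => c (s k x • x) := fun k =>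
      hc.comp ((hs_cont k).smul continuous_id)
    refine exists_homeomorph_push (hk n) (hk (n + 1)) (fun x => hinj _) fun x => ?_
    simp only [hs_succ]
    exact hstep x _ (hs_mem n x)
  choose Ψ hfst hmap hid using hpush
  obtain ⟨G, hG_fst, hG⟩ := exists_homeomorph_infinite_comp Ψ hfst fun x => by
    obtain ⟨N, hN⟩ := hs_one x
    refine ⟨N, hN.mono fun y hy n hn => hid n y ?_⟩
    rw [hy n hn, hy (n + 1) (hn.trans n.le_succ)]
  have hiter : ∀ n x i, iterComp Ψ n (x, c 0 i) = (x, c (s n x • x) i) := by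
    intro n x i
    induction n with
    | zero => simp [iterComp, s]
    | succ n ih => rw [← hmap, ← ih]; rfl
  refine ⟨G, hG_fst, fun x i => ?_⟩
  obtain ⟨N, hN⟩ := hG (x, c 0 i)
  obtain ⟨M, hM⟩ := hs_one x
  rw [hN _ (le_max_left N M), hiter, hM.self_of_nhds _ (le_max_right N M), one_smul]

/-- A point can be moved to any other one by an ambient homeomorphism fixing finitely many
points. -/
theorem exists_homeomorph_fixing_finite [CompleteSpace E] (hE : 1 < Module.rank ℝ E)
    {S : Set E} (hS : S.Finite) {a b : E} (ha : a ∉ S) (hb : b ∉ S) :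
    ∃ f : E ≃ₜ E, (∀ v ∈ S, f v = v) ∧ f a = b := by
  have := hS.fintype
  refine (hS.countable.isConnected_compl_of_one_lt_rank hE).isPreconnected.induction₂
    (fun a b => ∃ f : E ≃ₜ E, (∀ v ∈ S, f v = v) ∧ f a = b) ?_ ?_ ?_ ha hb
  · intro x hx
    let c : E → Option S → E := fun y o => o.elim y (↑)
    have hc : Continuous c := continuous_pi fun o => by
      cases o <;> simp only [c, Option.elim] <;> fun_prop
    have hinj : Function.Injective (c x) := by
      rintro (_ | ⟨u, hu⟩) (_ | ⟨v, hv⟩) h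
      · rfl
      · exact absurd (show x = v from h) fun h => hx (h ▸ hv)
      · exact absurd (show u = x from h) fun h => hx (h ▸ hu)
      · exact congrArg some (Subtype.ext h)
    have hev : ∀ᶠ y in nhds x, ∑ i, ‖c y i - c x i‖ < separation (c x) := by
      refine ContinuousAt.eventually_lt (Continuous.continuousAt (by fun_prop))
        continuousAt_const ?_
      simpa using separation_pos hinj
    refine (hev.filter_mono nhdsWithin_le_nhds).mono fun y hy => ?_
    obtain ⟨H, hfst, hmap, -⟩ := exists_homeomorph_push (X := Unit) (c := fun _ => c x)
      (c' := fun _ => c y) continuous_const continuous_const (fun _ => hinj) fun _ => hy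
    let f : E ≃ₜ E := ((Homeomorph.punitProd E).symm.trans H).trans (Homeomorph.punitProd E)
    have hf : ∀ o, f (c x o) = c y o := fun o => congrArg Prod.snd (hmap () o)
    exact ⟨f, fun v hv => hf (some ⟨v, hv⟩), hf none⟩
  · rintro x y z _ _ _ ⟨f, hf, hfx⟩ ⟨g, hg, hgy⟩
    exact ⟨f.trans g, fun v hv => by simp [hf v hv, hg v hv], by simp [hfx, hgy]⟩
  · rintro x y _ _ ⟨f, hf, hfx⟩
    exact ⟨f.symm, fun v hv => by rw [Homeomorph.symm_apply_eq, hf v hv],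
      by rw [Homeomorph.symm_apply_eq, hfx]⟩

/-- Any two configurations of finitely many distinct points are related by an ambient
homeomorphism. -/
theorem exists_homeomorph_config [CompleteSpace E] (hE : 1 < Module.rank ℝ E) {p q : ι → E}
    (hp : Function.Injective p) (hq : Function.Injective q) :
    ∃ f : E ≃ₜ E, ∀ i, f (p i) = q i := by
  classical
  suffices h : ∀ s : Finset ι, ∃ f : E ≃ₜ E, ∀ i ∈ s, f (p i) = q i by
    simpa using h Finset.univ
  intro s
  induction s using Finset.induction_on with
  | empty => exact ⟨Homeomorph.refl E, by simp⟩
  | insert j s hj ih =>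
    obtain ⟨f, hf⟩ := ih
    obtain ⟨g, hg, hgj⟩ := exists_homeomorph_fixing_finite hE (S := q '' s) (a := f (p j))
      (b := q j) (s.finite_toSet.image q)
      (by
        rintro ⟨i, hi, h⟩
        rw [← hf i hi] at h
        exact hj (hp (f.injective h) ▸ hi))
      (by
        rintro ⟨i, hi, h⟩
        exact hj (hq h ▸ hi))
    refine ⟨f.trans g, fun i hi => ?_⟩
    rcases Finset.mem_insert.1 hi with rfl | hi
    · exact hgj
    · simp only [Homeomorph.trans_apply, hf i hi]
      exact hg _ ⟨i, hi, rfl⟩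

end PointPushing

/-- The configuration space of one point on each strand of a 3-component string link together
with one free point in `ℝ³` is homeomorphic to the product of `ℝ³` with the complement of
three distinct points in `ℝ³`. -/
theorem configuration_space_of_strand_points_and_free_point_homeo
    (R : ℝ) (hR : 0 < R) (L : Fin 3 × ℝ → E3) (hL : IsStringLink 3 R L)
    (p : Fin 3 → E3) (hp : Function.Injective p) :
    Nonempty
      (({tx : (Fin 3 → ℝ) × E3 // ∀ i : Fin 3, tx.2 ≠ L (i, tx.1 i)}) ≃ₜ
        ((Fin 3 → ℝ) × {x : E3 // ∀ i : Fin 3, x ≠ p i})) := by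
  obtain ⟨hcont, hLinj, -⟩ := hL
  let c : (Fin 3 → ℝ) → Fin 3 → E3 := fun t i => L (i, t i)
  have hc : Continuous c := by fun_prop
  have hinj : ∀ t, Function.Injective (c t) := fun t i j h => congrArg Prod.fst (hLinj h)
  obtain ⟨H, hH_fst, hH⟩ := exists_homeomorph_trivialize hc hinj
  have hrank : 1 < Module.rank ℝ E3 := by
    rw [← Module.finrank_eq_rank, finrank_euclideanSpace_fin]
    norm_num
  obtain ⟨f, hf⟩ := exists_homeomorph_config hrank hp (hinj 0)
  let G : (Fin 3 → ℝ) × E3 ≃ₜ (Fin 3 → ℝ) × E3 :=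
    ((Homeomorph.refl (Fin 3 → ℝ)).prodCongr f).trans H
  have hG : ∀ t i, G (t, p i) = (t, c t i) := fun t i => by
    rw [← hH, ← hf]; rfl
  have hmem : ∀ z : (Fin 3 → ℝ) × E3, (∀ i, (G z).2 ≠ c (G z).1 i) ↔ ∀ i, z.2 ≠ p i := by
    rintro ⟨t, v⟩
    have hfst : (G (t, v)).1 = t := hH_fst _
    refine forall_congr' fun i => not_congr ?_
    rw [hfst]
    refine ⟨fun h => ?_, fun h => ?_⟩
    · have h' : G (t, v) = G (t, p i) := by rw [hG]; exact Prod.ext hfst h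
      exact congrArg Prod.snd (G.injective h')
    · change v = p i at h
      rw [h, hG]
  let K : {z : (Fin 3 → ℝ) × E3 // ∀ i, z.2 ≠ p i} ≃ₜ
      {tx : (Fin 3 → ℝ) × E3 // ∀ i, tx.2 ≠ L (i, tx.1 i)} :=
    G.subtype fun z => (hmem z).symm
  exact ⟨K.symm.trans
    { toFun := fun z => (z.1.1, ⟨z.1.2, z.2⟩)
      invFun := fun z => ⟨(z.1, z.2.1), z.2.2⟩
      left_inv := fun _ => rfl
      right_inv := fun _ => rfl
      continuous_toFun := by fun_prop
      continuous_invFun := by fun_prop }⟩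
end
end

section
/- Let p₀, p₁, p₂ be three pairwise distinct points of E³, let q₀, q₁, q₂ ∈ E³ and r₀, r₁, r₂ > 0 be such that the closed balls closedBall(qᵢ, rᵢ), i = 0, 1, 2, are pairwise disjoint. Then the complement E³ \ {p₀, p₁, p₂} of the three points is homeomorphic to the complement E³ \ (closedBall(q₀,r₀) ∪ closedBall(q₁,r₁) ∪ closedBall(q₂,r₂)) of the three closed balls. -/
noncomputable section

open Metric Set

section Interpolation

variable {ι E : Type*} [Finite ι] [NormedAddCommGroup E] [NormedSpace ℝ E]

/-- A function on finitely many distinct reals, with values in a subspace, extends to a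
continuous function on `ℝ` with values in the same subspace. -/
theorem exists_continuous_interpolation {t : ι → ℝ} (ht : Function.Injective t)
    (V : Submodule ℝ E) {c : ι → E} (hc : ∀ i, c i ∈ V) :
    ∃ G : ℝ → E, Continuous G ∧ (∀ i, G (t i) = c i) ∧ ∀ s, G s ∈ V := by
  classical
  have := Fintype.ofFinite ι
  refine ⟨fun s ↦ ∑ i, (Lagrange.basis Finset.univ t i).eval s • c i, ?_, fun j ↦ ?_, fun s ↦
    V.sum_mem fun i _ ↦ V.smul_mem _ (hc i)⟩
  · exact continuous_finsetSum _ fun i _ ↦ (Polynomial.continuous _).smul continuous_const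
  · dsimp only
    rw [Finset.sum_eq_single j]
    · simp [Lagrange.eval_basis_self ht.injOn (Finset.mem_univ j)]
    · intro i _ hij
      simp [Lagrange.eval_basis_of_ne hij (Finset.mem_univ j)]
    · simp

/-- The shear along a continuous curve `G` in the kernel of `f`. -/
def shearHomeomorph (f : E →L[ℝ] ℝ) (G : ℝ → E) (hG : Continuous G) (hfG : ∀ s, f (G s) = 0) :
    E ≃ₜ E where
  toFun x := x + G (f x)
  invFun x := x - G (f x)
  left_inv x := by simp [hfG]
  right_inv x := by simp [hfG]
  continuous_toFun := by fun_prop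
  continuous_invFun := by fun_prop

theorem exists_homeomorph_apply_eq_of_functional (f : E →L[ℝ] ℝ) {a b : ι → E}
    (ha : Function.Injective fun i ↦ f (a i)) (hab : ∀ i, f (a i) = f (b i)) :
    ∃ h : E ≃ₜ E, ∀ i, h (a i) = b i := by
  obtain ⟨G, hG, hGa, hfG⟩ := exists_continuous_interpolation ha (LinearMap.ker f.toLinearMap)
    (c := fun i ↦ b i - a i) (fun i ↦ by simp [hab])
  refine ⟨shearHomeomorph f G hG hfG, fun i ↦ ?_⟩
  change a i + G (f (a i)) = b i
  rw [hGa, add_sub_cancel]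

/-- The homeomorphism group of a real vector space of dimension at least two acts transitively
on finite families of distinct points. -/
theorem exists_homeomorph_apply_eq [FiniteDimensional ℝ E] (hE : 1 < Module.finrank ℝ E)
    {p q : ι → E} (hp : Function.Injective p) (hq : Function.Injective q) :
    ∃ h : E ≃ₜ E, ∀ i, h (p i) = q i := by
  classical
  obtain ⟨f₀, hf₀⟩ := Module.exists_dual_forall_apply_ne_zero (K := ℝ)
    (Sum.elim (fun x : {x : ι × ι // x.1 ≠ x.2} ↦ p x.1.1 - p x.1.2)
      (fun x : {x : ι × ι // x.1 ≠ x.2} ↦ q x.1.1 - q x.1.2)) (by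
        rintro (⟨x, hx⟩ | ⟨x, hx⟩)
        · exact sub_ne_zero.2 (hp.ne hx)
        · exact sub_ne_zero.2 (hq.ne hx))
  obtain ⟨w, hw, hw₀⟩ := Submodule.exists_mem_ne_zero_of_ne_bot
    (f₀.ker_ne_bot_of_finrank_lt (by simpa using hE))
  set f : E →L[ℝ] ℝ := LinearMap.toContinuousLinearMap f₀
  have hfp : Function.Injective fun i ↦ f (p i) := fun i j hij ↦ by
    by_contra hne
    exact hf₀ (.inl ⟨(i, j), hne⟩) ((map_sub f₀ _ _).trans (sub_eq_zero.2 hij))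
  have hfq : Function.Injective fun i ↦ f (q i) := fun i j hij ↦ by
    by_contra hne
    exact hf₀ (.inr ⟨(i, j), hne⟩) ((map_sub f₀ _ _).trans (sub_eq_zero.2 hij))
  replace hw : f w = 0 := hw
  rcases subsingleton_or_nontrivial ι with hι | hι
  · rcases isEmpty_or_nonempty ι with hι' | ⟨⟨i₀⟩⟩
    · exact ⟨.refl E, fun i ↦ isEmptyElim i⟩
    · exact ⟨.addRight (q i₀ - p i₀), fun i ↦ by simp [Subsingleton.elim i i₀]⟩
  obtain ⟨u, hu⟩ : ∃ u, f u ≠ 0 := by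
    obtain ⟨i, j, hij⟩ := exists_pair_ne ι
    exact ⟨p i - p j, hf₀ (.inl ⟨(i, j), hij⟩)⟩
  obtain ⟨g, hg⟩ := SeparatingDual.exists_eq_one (R := ℝ) hw₀
  obtain ⟨v, hfv, hgv⟩ : ∃ v, f v = 1 ∧ g v = 0 :=
    ⟨(f u)⁻¹ • (u - g u • w), by simp [hw, hu], by simp [hg]⟩
  obtain ⟨h₁, hh₁⟩ := exists_homeomorph_apply_eq_of_functional f
    (b := fun i ↦ f (p i) • v + f (p i) • w) hfp (by simp [hfv, hw])
  obtain ⟨h₂, hh₂⟩ := exists_homeomorph_apply_eq_of_functional g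
    (a := fun i ↦ f (p i) • v + f (p i) • w) (b := fun i ↦ f (q i) • v + f (p i) • w)
    (by simpa [hg, hgv] using hfp) (by simp [hg, hgv])
  obtain ⟨h₃, hh₃⟩ := exists_homeomorph_apply_eq_of_functional f
    (a := fun i ↦ f (q i) • v + f (p i) • w) (b := q)
    (by simpa [hfv, hw] using hfq) (by simp [hfv, hw])
  exact ⟨(h₁.trans h₂).trans h₃, fun i ↦ by simp [hh₁, hh₂, hh₃]⟩

end Interpolation

section Radial

variable {E : Type*} [NormedAddCommGroup E] [NormedSpace ℝ E]

/-- Radial expansion about `q`, opening the point `q` to the closed ball of radius `r` and fixing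
all points at distance at least `R` from `q`. -/
def radialExpand (q : E) (r R : ℝ) (x : E) : E :=
  q + max 1 (r / ‖x - q‖ + (1 - r / R)) • (x - q)

/-- The inverse of `radialExpand`. -/
def radialContract (q : E) (r R : ℝ) (y : E) : E :=
  q + min 1 ((1 - r / ‖y - q‖) / (1 - r / R)) • (y - q)

variable {q x y : E} {r R : ℝ}

theorem radialExpand_eq_self (hr : 0 < r) (hR : r < R) (hx : R ≤ ‖x - q‖) :
    radialExpand q r R x = x := by
  have h : r / ‖x - q‖ ≤ r / R := div_le_div_of_nonneg_left hr.le (hr.trans hR) hx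
  rw [radialExpand, max_eq_left (by linarith)]
  simp

theorem radialContract_eq_self (hr : 0 < r) (hR : r < R) (hy : R ≤ ‖y - q‖) :
    radialContract q r R y = y := by
  have h : r / ‖y - q‖ ≤ r / R := div_le_div_of_nonneg_left hr.le (hr.trans hR) hy
  have h' : r / R < 1 := (div_lt_one (hr.trans hR)).2 hR
  rw [radialContract, min_eq_left ((one_le_div (by linarith)).2 (by linarith))]
  simp

theorem radialExpand_eq (hr : 0 < r) (hx₀ : x ≠ q) (hx : ‖x - q‖ ≤ R) :
    radialExpand q r R x = q + (r / ‖x - q‖ + (1 - r / R)) • (x - q) := by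
  have h : r / R ≤ r / ‖x - q‖ :=
    div_le_div_of_nonneg_left hr.le (norm_pos_iff.2 (sub_ne_zero.2 hx₀)) hx
  rw [radialExpand, max_eq_right (by linarith)]

theorem radialContract_eq (hr : 0 < r) (hR : r < R) (hy₀ : r < ‖y - q‖) (hy : ‖y - q‖ ≤ R) :
    radialContract q r R y = q + ((1 - r / ‖y - q‖) / (1 - r / R)) • (y - q) := by
  have h : r / R ≤ r / ‖y - q‖ := div_le_div_of_nonneg_left hr.le (hr.trans hy₀) hy
  have h' : r / R < 1 := (div_lt_one (hr.trans hR)).2 hR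
  rw [radialContract, min_eq_right ((div_le_one (by linarith)).2 (by linarith))]

theorem norm_radialExpand_sub (hr : 0 < r) (hR : r < R) (hx₀ : x ≠ q) (hx : ‖x - q‖ ≤ R) :
    ‖radialExpand q r R x - q‖ = r + (1 - r / R) * ‖x - q‖ := by
  have h₀ : 0 < ‖x - q‖ := norm_pos_iff.2 (sub_ne_zero.2 hx₀)
  have h' : r / R < 1 := (div_lt_one (hr.trans hR)).2 hR
  have h : 0 < r / ‖x - q‖ := div_pos hr h₀
  rw [radialExpand_eq hr hx₀ hx, add_sub_cancel_left, norm_smul, Real.norm_eq_abs,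
    abs_of_pos (by linarith), add_mul, div_mul_cancel₀ _ h₀.ne']

theorem norm_radialContract_sub (hr : 0 < r) (hR : r < R) (hy₀ : r < ‖y - q‖)
    (hy : ‖y - q‖ ≤ R) :
    ‖radialContract q r R y - q‖ = (‖y - q‖ - r) / (1 - r / R) := by
  have h₀ : 0 < ‖y - q‖ := hr.trans hy₀
  have h' : r / R < 1 := (div_lt_one (hr.trans hR)).2 hR
  have h : r / ‖y - q‖ < 1 := (div_lt_one h₀).2 hy₀
  rw [radialContract_eq hr hR hy₀ hy, add_sub_cancel_left, norm_smul, Real.norm_eq_abs,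
    abs_of_pos (div_pos (by linarith) (by linarith)), div_mul_eq_mul_div, sub_mul,
    div_mul_cancel₀ _ h₀.ne', one_mul]

theorem norm_radialExpand_sub_le (hr : 0 < r) (hR : r < R) (hx₀ : x ≠ q) (hx : ‖x - q‖ ≤ R) :
    ‖radialExpand q r R x - q‖ ≤ R := by
  have h' : r / R < 1 := (div_lt_one (hr.trans hR)).2 hR
  rw [norm_radialExpand_sub hr hR hx₀ hx]
  calc r + (1 - r / R) * ‖x - q‖ ≤ r + (1 - r / R) * R := by
        gcongr
    _ = R := by
        have := (hr.trans hR).ne'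
        field_simp
        ring

theorem norm_radialContract_sub_le (hr : 0 < r) (hR : r < R) (hy₀ : r < ‖y - q‖)
    (hy : ‖y - q‖ ≤ R) : ‖radialContract q r R y - q‖ ≤ R := by
  have h' : r / R < 1 := (div_lt_one (hr.trans hR)).2 hR
  rw [norm_radialContract_sub hr hR hy₀ hy, div_le_iff₀ (by linarith), mul_sub, mul_one,
    mul_div_cancel₀ _ (hr.trans hR).ne']
  linarith

theorem lt_norm_radialExpand_sub (hr : 0 < r) (hR : r < R) (hx₀ : x ≠ q) :
    r < ‖radialExpand q r R x - q‖ := by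
  rcases le_total R ‖x - q‖ with hx | hx
  · rw [radialExpand_eq_self hr hR hx]
    exact hR.trans_le hx
  · have h' : r / R < 1 := (div_lt_one (hr.trans hR)).2 hR
    rw [norm_radialExpand_sub hr hR hx₀ hx]
    exact lt_add_of_pos_right _ (mul_pos (by linarith) (norm_pos_iff.2 (sub_ne_zero.2 hx₀)))

theorem radialContract_ne (hr : 0 < r) (hR : r < R) (hy₀ : r < ‖y - q‖) :
    radialContract q r R y ≠ q := by
  rw [← sub_ne_zero, ← norm_pos_iff]
  rcases le_total R ‖y - q‖ with hy | hy
  · rw [radialContract_eq_self hr hR hy]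
    exact hr.trans hy₀
  · have h' : r / R < 1 := (div_lt_one (hr.trans hR)).2 hR
    rw [norm_radialContract_sub hr hR hy₀ hy]
    exact div_pos (by linarith) (by linarith)

theorem radialContract_radialExpand (hr : 0 < r) (hR : r < R) (hx₀ : x ≠ q) :
    radialContract q r R (radialExpand q r R x) = x := by
  rcases le_total R ‖x - q‖ with hx | hx
  · rw [radialExpand_eq_self hr hR hx, radialContract_eq_self hr hR hx]
  · have h' : r / R < 1 := (div_lt_one (hr.trans hR)).2 hR
    have h₀ : 0 < ‖x - q‖ := norm_pos_iff.2 (sub_ne_zero.2 hx₀)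
    have h₁ : 0 < 1 - r / R := by linarith
    rw [radialContract_eq hr hR (lt_norm_radialExpand_sub hr hR hx₀)
      (norm_radialExpand_sub_le hr hR hx₀ hx), norm_radialExpand_sub hr hR hx₀ hx,
      radialExpand_eq hr hx₀ hx, add_sub_cancel_left, smul_smul]
    generalize 1 - r / R = k at h₁
    have h₂ : 0 < r + k * ‖x - q‖ := by positivity
    have h₃ : (1 - r / (r + k * ‖x - q‖)) / k * (r / ‖x - q‖ + k) = 1 := by
      field_simp
      ring
    rw [h₃, one_smul, add_sub_cancel]

theorem radialExpand_radialContract (hr : 0 < r) (hR : r < R) (hy₀ : r < ‖y - q‖) :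
    radialExpand q r R (radialContract q r R y) = y := by
  rcases le_total R ‖y - q‖ with hy | hy
  · rw [radialContract_eq_self hr hR hy, radialExpand_eq_self hr hR hy]
  · have h' : r / R < 1 := (div_lt_one (hr.trans hR)).2 hR
    have h₀ : 0 < ‖y - q‖ := hr.trans hy₀
    have h₁ : 0 < 1 - r / R := by linarith
    have h₂ : 0 < ‖y - q‖ - r := by linarith
    rw [radialExpand_eq hr (radialContract_ne hr hR hy₀)
      (norm_radialContract_sub_le hr hR hy₀ hy), norm_radialContract_sub hr hR hy₀ hy,
      radialContract_eq hr hR hy₀ hy, add_sub_cancel_left, smul_smul]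
    generalize 1 - r / R = k at h₁
    have h₃ : (r / ((‖y - q‖ - r) / k) + k) * ((1 - r / ‖y - q‖) / k) = 1 := by
      field_simp
      ring
    rw [h₃, one_smul, add_sub_cancel]

theorem continuousOn_radialExpand : ContinuousOn (radialExpand q r R) {q}ᶜ := by
  have h : ∀ x ∈ ({q}ᶜ : Set E), ‖x - q‖ ≠ 0 := fun x hx ↦ norm_ne_zero_iff.2 (sub_ne_zero.2 hx)
  unfold radialExpand
  fun_prop (disch := assumption)

theorem continuousOn_radialContract : ContinuousOn (radialContract q r R) {q}ᶜ := by
  have h : ∀ x ∈ ({q}ᶜ : Set E), ‖x - q‖ ≠ 0 := fun x hx ↦ norm_ne_zero_iff.2 (sub_ne_zero.2 hx)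
  unfold radialContract
  fun_prop (disch := assumption)

/-- Away from a closed set `C` disjoint from the ball, removing a point and removing a closed
ball around it give homeomorphic spaces. -/
theorem nonempty_homeomorph_compl_insert_compl_closedBall_union [ProperSpace E] (hr : 0 < r)
    {C : Set E} (hC : IsClosed C) (hdisj : Disjoint (closedBall q r) C) :
    Nonempty (↥(insert q C)ᶜ ≃ₜ ↥(closedBall q r ∪ C)ᶜ) := by
  obtain ⟨δ, hδ, hδC⟩ := (isCompact_closedBall q r).exists_cthickening_subset_open
    hC.isOpen_compl hdisj.subset_compl_right
  rw [cthickening_closedBall hδ.le hr.le] at hδC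
  obtain ⟨R, hR, hRC⟩ : ∃ R, r < R ∧ ∀ x, ‖x - q‖ ≤ R → x ∉ C :=
    ⟨δ + r, by linarith, fun x hx ↦ hδC (by simpa [dist_eq_norm, add_comm] using hx)⟩
  have hne : ∀ x ∈ (insert q C)ᶜ, x ≠ q := fun x hx h ↦ hx (.inl h)
  have hlt : ∀ y ∈ (closedBall q r ∪ C)ᶜ, r < ‖y - q‖ := fun y hy ↦ by
    by_contra! h
    exact hy (.inl (by simpa [dist_eq_norm] using h))
  refine ⟨⟨⟨fun x ↦ ⟨radialExpand q r R x, ?_⟩, fun y ↦ ⟨radialContract q r R y, ?_⟩,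
    fun x ↦ Subtype.ext (radialContract_radialExpand hr hR (hne x x.2)),
    fun y ↦ Subtype.ext (radialExpand_radialContract hr hR (hlt y y.2))⟩, ?_, ?_⟩⟩
  · have hx := hne x x.2
    rintro (h | h)
    · rw [mem_closedBall, dist_eq_norm] at h
      exact h.not_gt (lt_norm_radialExpand_sub hr hR hx)
    · rcases le_total R ‖(x : E) - q‖ with hxR | hxR
      · rw [radialExpand_eq_self hr hR hxR] at h
        exact x.2 (.inr h)
      · exact hRC _ (norm_radialExpand_sub_le hr hR hx hxR) h
  · have hy := hlt y y.2
    rintro (h | h)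
    · exact radialContract_ne hr hR hy h
    · rcases le_total R ‖(y : E) - q‖ with hyR | hyR
      · rw [radialContract_eq_self hr hR hyR] at h
        exact y.2 (.inr h)
      · exact hRC _ (norm_radialContract_sub_le hr hR hy hyR) h
  · exact (continuousOn_radialExpand.comp_continuous continuous_subtype_val
      fun x ↦ hne x x.2).subtype_mk _
  · refine (continuousOn_radialContract.comp_continuous continuous_subtype_val
      fun y hy ↦ ?_).subtype_mk _
    have := hlt y y.2
    rw [mem_singleton_iff.1 hy, sub_self, norm_zero] at this
    exact hr.not_gt this

end Radial

/-- The complement of three distinct points in `ℝ³` is homeomorphic to the complement of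
three pairwise disjoint closed balls in `ℝ³`. -/
theorem complement_three_points_homeo_complement_three_balls
    (p₀ p₁ p₂ : E3) (hp₀₁ : p₀ ≠ p₁) (hp₀₂ : p₀ ≠ p₂) (hp₁₂ : p₁ ≠ p₂)
    (q₀ q₁ q₂ : E3) (r₀ r₁ r₂ : ℝ) (hr₀ : 0 < r₀) (hr₁ : 0 < r₁) (hr₂ : 0 < r₂)
    (h₀₁ : Disjoint (Metric.closedBall q₀ r₀) (Metric.closedBall q₁ r₁))
    (h₀₂ : Disjoint (Metric.closedBall q₀ r₀) (Metric.closedBall q₂ r₂))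
    (h₁₂ : Disjoint (Metric.closedBall q₁ r₁) (Metric.closedBall q₂ r₂)) :
    Nonempty
      ((↥(({p₀, p₁, p₂} : Set E3)ᶜ)) ≃ₜ
        (↥((Metric.closedBall q₀ r₀ ∪ Metric.closedBall q₁ r₁ ∪
            Metric.closedBall q₂ r₂)ᶜ))) := by
  have hcenter : ∀ {q : E3} {r : ℝ}, 0 < r → q ∈ closedBall q r :=
    fun hr ↦ mem_closedBall_self hr.le
  have hq₀₁ := h₀₁.ne_of_mem (hcenter hr₀) (hcenter hr₁)
  have hq₀₂ := h₀₂.ne_of_mem (hcenter hr₀) (hcenter hr₂)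
  have hq₁₂ := h₁₂.ne_of_mem (hcenter hr₁) (hcenter hr₂)
  have hinj : ∀ a b c : E3, a ≠ b → a ≠ c → b ≠ c → Function.Injective ![a, b, c] := by
    intro a b c hab hac hbc i j hij
    fin_cases i <;> fin_cases j <;> simp_all
  obtain ⟨h, hh⟩ := exists_homeomorph_apply_eq (by simp) (hinj p₀ p₁ p₂ hp₀₁ hp₀₂ hp₁₂)
    (hinj q₀ q₁ q₂ hq₀₁ hq₀₂ hq₁₂)
  have h0 : h p₀ = q₀ := hh 0
  have h1 : h p₁ = q₁ := hh 1
  have h2 : h p₂ = q₂ := hh 2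
  have e : ↥({p₀, p₁, p₂} : Set E3)ᶜ ≃ₜ ↥({q₀, q₁, q₂} : Set E3)ᶜ :=
    h.subtype fun x ↦ by simp [← h0, ← h1, ← h2]
  obtain ⟨e₀⟩ := nonempty_homeomorph_compl_insert_compl_closedBall_union (q := q₀) hr₀
    (C := {q₁, q₂}) (Set.toFinite _).isClosed (by
      rw [disjoint_insert_right, disjoint_singleton_right]
      exact ⟨h₀₁.notMem_of_mem_right (hcenter hr₁), h₀₂.notMem_of_mem_right (hcenter hr₂)⟩)
  obtain ⟨e₁⟩ := nonempty_homeomorph_compl_insert_compl_closedBall_union (q := q₁) hr₁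
    (C := closedBall q₀ r₀ ∪ {q₂}) (isClosed_closedBall.union isClosed_singleton)
    (h₀₁.symm.union_right (disjoint_singleton_right.2
      (h₁₂.notMem_of_mem_right (hcenter hr₂))))
  obtain ⟨e₂⟩ := nonempty_homeomorph_compl_insert_compl_closedBall_union (q := q₂) hr₂
    (C := closedBall q₀ r₀ ∪ closedBall q₁ r₁) (isClosed_closedBall.union isClosed_closedBall)
    (h₀₂.symm.union_right h₁₂.symm)
  refine ⟨e.trans <| e₀.trans <| (Homeomorph.setCongr ?_).trans <| e₁.trans <|
    (Homeomorph.setCongr ?_).trans <| e₂.trans <| Homeomorph.setCongr ?_⟩ <;>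
  · ext x
    simp only [mem_compl_iff, mem_union, mem_insert_iff, mem_singleton_iff]
    tauto
end
end

section
/- Let A := {v ∈ S² : v 2 = 0 and v 0 ≥ 0} be the closed half-equator arc of S². Then the complement S² \ A is path-connected. -/
noncomputable section

open Metric Set

/-- The closed half-equator arc `A = {v ∈ S² : v 2 = 0 ∧ v 0 ≥ 0}`. -/
def arcA : Set E3 := {v ∈ S2 | v 2 = 0 ∧ 0 ≤ v 0}

/-- The complement in `E³` of the closed half-plane `v 2 = 0`, `v 0 ≥ 0` is star-convex about
`(-1, 0, 0)`. -/
theorem starConvex_compl_halfPlane :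
    StarConvex ℝ (!₂[-1, 0, 0] : E3) {v : E3 | v 2 = 0 → v 0 < 0} := by
  intro v hv a b ha hb hab
  simp only [mem_ofPred_eq] at hv
  simp only [mem_ofPred_eq, PiLp.add_apply, PiLp.smul_apply, smul_eq_mul,
    Matrix.cons_val, mul_zero, zero_add, mul_eq_zero]
  rintro (hb0 | h)
  · subst hb0
    linarith
  · rcases ha.eq_or_lt with rfl | ha
    · nlinarith [hv h]
    · nlinarith [mul_nonneg hb (neg_nonneg.2 (hv h).le)]

theorem isPathConnected_compl_halfPlane : IsPathConnected {v : E3 | v 2 = 0 → v 0 < 0} := by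
  refine ⟨!₂[-1, 0, 0], by simp, fun {v} hv => ?_⟩
  exact JoinedIn.of_segment_subset (starConvex_compl_halfPlane.segment_subset hv)

/-- The complement of the arc is the radial projection of the complement of a half-plane. -/
theorem image_normalize_compl_halfPlane :
    (fun v : E3 => ‖v‖⁻¹ • v) '' {v : E3 | v 2 = 0 → v 0 < 0} = S2 \ arcA := by
  ext w
  simp only [S2, arcA, mem_image, mem_sdiff, mem_ofPred_eq, mem_sphere_zero_iff_norm]
  constructor
  · rintro ⟨v, hv, rfl⟩
    have hv0 : v ≠ 0 := by
      rintro rfl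
      simp at hv
    have hn : 0 < ‖v‖⁻¹ := inv_pos.2 (norm_pos_iff.2 hv0)
    refine ⟨norm_smul_inv_norm (𝕜 := ℝ) hv0, ?_⟩
    rintro ⟨-, h2, h0⟩
    simp only [PiLp.smul_apply, smul_eq_mul] at h2 h0
    exact (nonneg_of_mul_nonneg_right h0 hn).not_gt
      (hv ((mul_eq_zero.1 h2).resolve_left hn.ne'))
  · rintro ⟨hw, h⟩
    refine ⟨w, fun h2 => ?_, by simp [hw]⟩
    by_contra! h0
    exact h ⟨hw, h2, h0⟩

/-- The complement in `S²` of the closed half-equator arc `A` is path-connected. -/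
theorem sphere_minus_half_equator_path_connected :
    IsPathConnected (S2 \ arcA) := by
  rw [← image_normalize_compl_halfPlane]
  refine isPathConnected_compl_halfPlane.image' fun v hv => ContinuousAt.continuousWithinAt ?_
  have hv0 : ‖v‖ ≠ 0 := by
    rw [norm_ne_zero_iff]
    rintro rfl
    simp at hv
  exact (continuousAt_id.norm.inv₀ hv0).smul continuousAt_id
end
end

section
/- Let k ≥ 1 and let O_k := {f : Fin k → ℝ // 0 ≤ f i for all i} be the closed octant in ℝ^k, with the subspace topology. Let Q be the quotient of Bool × O_k by the equivalence relation generated by identifying (true, f) with (false, f) whenever f 0 = 0 (i.e., two copies of the corner model [0,∞)^k glued along the codimension-1 face {f 0 = 0}). Then Q is homeomorphic to ℝ × O_{k−1}, i.e., to ℝ × [0,∞)^{k−1}. (Gluing two corner models of codimension k along a common codimension-1 face yields a corner model of codimension k − 1.) -/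
noncomputable section

open Set

/-- The closed octant `O_k = [0,∞)^k` in `ℝ^k`, with the subspace topology. -/
abbrev Oct (k : ℕ) : Type := {f : Fin k → ℝ // ∀ i, 0 ≤ f i}

/-- The relation identifying `(true, f)` with `(false, f)` whenever `f 0 = 0`
(in `Bool × O_k`, i.e. in two copies of the corner model `[0,∞)^k`). -/
def glueRel (k : ℕ) (hk : 0 < k) : Bool × Oct k → Bool × Oct k → Prop :=
  fun a b =>
    a.1 = true ∧ b.1 = false ∧ a.2 = b.2 ∧ (a.2 : Fin k → ℝ) ⟨0, hk⟩ = 0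

namespace Oct

/-- Forget the first coordinate of a point of the octant. -/
def tail {n : ℕ} (f : Oct (n + 1)) : Oct n :=
  ⟨Fin.tail f.1, fun i => f.2 i.succ⟩

/-- Prepend `|t|` to a point of the octant. -/
def consAbs {n : ℕ} (t : ℝ) (g : Oct n) : Oct (n + 1) :=
  ⟨Fin.cons |t| g.1, Fin.cases (by simp) (by simpa using g.2)⟩

@[simp]
theorem consAbs_zero {n : ℕ} (t : ℝ) (g : Oct n) : (consAbs t g).1 0 = |t| := rfl

@[simp]
theorem tail_consAbs {n : ℕ} (t : ℝ) (g : Oct n) : (consAbs t g).tail = g := rfl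

theorem consAbs_tail {n : ℕ} {t : ℝ} {f : Oct (n + 1)} (h : |t| = f.1 0) :
    consAbs t f.tail = f :=
  Subtype.ext <| by simp [consAbs, tail, h]

theorem continuous_tail {n : ℕ} : Continuous (tail : Oct (n + 1) → Oct n) :=
  Continuous.subtype_mk
    (continuous_pi fun i => (continuous_apply i.succ).comp continuous_subtype_val) _

theorem continuous_consAbs {n : ℕ} : Continuous fun p : ℝ × Oct n => consAbs p.1 p.2 := by
  refine Continuous.subtype_mk (continuous_pi <| Fin.cases ?_ fun i => ?_) _
  · simpa using continuous_fst.abs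
  · exact (continuous_apply i).comp (continuous_subtype_val.comp continuous_snd)

end Oct

/-- The first coordinate of a point of the double of the octant, with the sign given by its copy. -/
def signedCoord {n : ℕ} (p : Bool × Oct (n + 1)) : ℝ :=
  if p.1 then p.2.1 0 else -p.2.1 0

theorem continuous_signedCoord {n : ℕ} :
    Continuous (signedCoord : Bool × Oct (n + 1) → ℝ) := by
  have h : Continuous fun f : Oct (n + 1) => f.1 0 :=
    (continuous_apply 0).comp continuous_subtype_val
  refine continuous_prod_of_discrete_left.2 fun b => ?_
  cases b
  · exact h.neg
  · exact h

/-- The double of the octant along its first face is a product of a line and a smaller octant. -/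
def glueHomeomorph (n : ℕ) : Quot (glueRel (n + 1) n.succ_pos) ≃ₜ ℝ × Oct n where
  toFun := Quot.lift (fun p => (signedCoord p, p.2.tail)) <| by
    rintro ⟨_, f⟩ ⟨_, _⟩ ⟨rfl, rfl, rfl, h⟩
    have h : f.1 0 = 0 := h
    simp [signedCoord, h]
  invFun p := if 0 ≤ p.1 then Quot.mk _ (true, Oct.consAbs p.1 p.2)
    else Quot.mk _ (false, Oct.consAbs p.1 p.2)
  left_inv := by
    rintro ⟨b, f⟩
    have hf : 0 ≤ f.1 0 := f.2 0
    cases b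
    · rcases hf.eq_or_lt with h | h
      · have hc : Oct.consAbs 0 f.tail = f := Oct.consAbs_tail (by simp [← h])
        simpa [signedCoord, ← h, hc] using Quot.sound ⟨rfl, rfl, rfl, h.symm⟩
      · have hc : Oct.consAbs (-f.1 0) f.tail = f :=
          Oct.consAbs_tail (by rw [abs_neg, abs_of_pos h])
        simp [signedCoord, not_le.2 h, hc]
    · have hc : Oct.consAbs (f.1 0) f.tail = f := Oct.consAbs_tail (abs_of_nonneg hf)
      simp [signedCoord, hf, hc]
  right_inv := by
    rintro ⟨t, g⟩
    by_cases h : 0 ≤ t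
    · simp [h, signedCoord, abs_of_nonneg h]
    · simp [h, signedCoord, abs_of_neg (not_le.1 h)]
  continuous_toFun :=
    continuous_quot_lift _
      (continuous_signedCoord.prodMk (Oct.continuous_tail.comp continuous_snd))
  continuous_invFun := by
    refine Continuous.if_le ?_ ?_ continuous_const continuous_fst ?_
    · exact continuous_quot_mk.comp (continuous_const.prodMk Oct.continuous_consAbs)
    · exact continuous_quot_mk.comp (continuous_const.prodMk Oct.continuous_consAbs)
    · rintro ⟨t, g⟩ h
      have h : 0 = t := h
      exact Quot.sound ⟨rfl, rfl, rfl, show |t| = 0 by simp [← h]⟩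

/-- Gluing two copies of the corner model `[0,∞)^k` along the codimension-1 face `{f 0 = 0}`
yields a space homeomorphic to `ℝ × [0,∞)^(k−1)`. -/
theorem glued_octants_homeo (k : ℕ) (hk : 0 < k) :
    Nonempty (Quot (glueRel k hk) ≃ₜ (ℝ × Oct (k - 1))) := by
  obtain ⟨n, rfl⟩ := Nat.exists_eq_add_one.2 hk
  exact ⟨glueHomeomorph n⟩
end
end
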